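/- Let G be a finite group and π a set of primes such that d_π(G) < 1. Then d_π(G) ≤ 2/3. -/

import Mathlib

open scoped Classical Pointwise

/-- A `π`-element: every prime divisor of its order lies in `π`. -/
def IsPiElement {G : Type*} [Group G] (π : Set ℕ) (x : G) : Prop :=
  ∀ q : ℕ, q.Prime → q ∣ orderOf x → q ∈ π

/-- `kPi π G` is the number of conjugacy classes of `π`-elements of `G`. -/
noncomputable def kPi (π : Set ℕ) (G : Type*) [Group G] : ℕ :=
  Nat.card {c : ConjClasses G | ∃ x : G, ConjClasses.mk x = c ∧ IsPiElement π x}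

/-- The `π`-part of a natural number: the largest divisor all of whose prime
divisors lie in `π`. -/
noncomputable def piPart (π : Set ℕ) (n : ℕ) : ℕ :=
  n.factorization.prod fun p k => if p ∈ π then p ^ k else 1

/-- `dPi π G = kPi π G / |G|_π`. -/
noncomputable def dPi (π : Set ℕ) (G : Type*) [Group G] : ℚ :=
  (kPi π G : ℚ) / (piPart π (Nat.card G) : ℚ)

open Finset in
lemma count_aux {X Y : Type*} [Finite X] [Finite Y] (f : X → Y) (Z : Set X) (m : ℕ)
    (hm : 1 ≤ m)
    (hf : ∀ x, x ∉ Z → ∃ t : Finset X, m ≤ t.card ∧ ∀ y ∈ t, f y = f x) :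
    m * (Set.range f).ncard ≤ Nat.card X + (m - 1) * Z.ncard := by
  have := Fintype.ofFinite X
  have := Fintype.ofFinite Y
  have e1 : (Set.range f).ncard = (Finset.univ.image f).card := by
    rw [← Set.ncard_coe_finset]; simp
  have e2 : Z.ncard = (Finset.univ.filter (· ∈ Z)).card := by
    rw [← Set.ncard_coe_finset]; simp
  rw [e1, e2, Nat.card_eq_fintype_card, ← Finset.card_univ,
    Finset.card_eq_sum_card_image f Finset.univ,
    Finset.card_eq_sum_card_fiberwise (s := Finset.univ.filter (· ∈ Z)) (f := f)
      (t := Finset.univ.image f) (by intro x _; simp),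
    Finset.mul_sum, ← Finset.sum_add_distrib, mul_comm, ← smul_eq_mul, ← Finset.sum_const]
  apply Finset.sum_le_sum
  intro y hy
  obtain ⟨x, -, rfl⟩ := Finset.mem_image.1 hy
  by_cases h : ∃ z ∈ Z, f z = f x
  · obtain ⟨z, hz, hzx⟩ := h
    have h1 : 0 < (Finset.univ.filter (fun a => f a = f x)).card :=
      Finset.card_pos.2 ⟨x, by simp⟩
    have h2 : 0 < ((Finset.univ.filter (· ∈ Z)).filter (fun a => f a = f x)).card :=
      Finset.card_pos.2 ⟨z, by simp [hz, hzx]⟩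
    have h3 := Nat.mul_le_mul_left (m - 1) h2
    simp only [Nat.succ_eq_add_one, zero_add, mul_one] at h3
    omega
  · obtain ⟨t, ht, htf⟩ := hf x (fun hx => h ⟨x, hx, rfl⟩)
    have : t.card ≤ (Finset.univ.filter (fun a => f a = f x)).card :=
      Finset.card_le_card (fun a ha => by simp [htf a ha])
    omega

lemma isPi_of_dvd {G : Type*} [Group G] {π : Set ℕ} {x : G} {n : ℕ} (h : orderOf x ∣ n)
    (hn : ∀ q : ℕ, q.Prime → q ∣ n → q ∈ π) : IsPiElement π x :=
  fun q hq hqx => hn q hq (hqx.trans h)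

lemma kPi_eq {G : Type*} [Group G] [Finite G] (π : Set ℕ) :
    kPi π G = {c : ConjClasses G | ∃ x : G, ConjClasses.mk x = c ∧ IsPiElement π x}.ncard :=
  Nat.card_coe_set_eq _

lemma p_decomp {G : Type*} [Group G] [Finite G] (s : Set ℕ) (p : ℕ) (hp : p.Prime) (y : G)
    (hy : IsPiElement (insert p s) y) :
    ∃ a b : G, y = a * b ∧ Commute a b ∧ IsPiElement {p} a ∧ IsPiElement s b := by
  have hn : orderOf y ≠ 0 := (orderOf_pos y).ne'
  set k := (orderOf y).factorization p
  set m := orderOf y / p ^ k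
  have hkm : p ^ k * m = orderOf y := Nat.ordProj_mul_ordCompl_eq_self _ _
  have hpm : ¬ p ∣ m := Nat.not_dvd_ordCompl hp hn
  have hc : Nat.Coprime (p ^ k) m := Nat.Coprime.pow_left _ ((hp.coprime_iff_not_dvd).2 hpm)
  obtain ⟨u, hu1, hu0⟩ := Nat.chineseRemainder hc 1 0
  obtain ⟨v, hv0, hv1⟩ := Nat.chineseRemainder hc 0 1
  refine ⟨y ^ u, y ^ v, ?_, ?_, ?_, ?_⟩
  · rw [← pow_add]
    have : u + v ≡ 1 [MOD orderOf y] := by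
      rw [← hkm]
      exact (Nat.modEq_and_modEq_iff_modEq_mul hc).1 ⟨hu1.add hv0, hu0.add hv1⟩
    conv_lhs => rw [← pow_one y]
    exact (pow_eq_pow_iff_modEq.2 this).symm
  · exact (Commute.refl y).pow_pow _ _
  · refine isPi_of_dvd (n := p ^ k) ?_ ?_
    · apply orderOf_dvd_of_pow_eq_one
      rw [← pow_mul]
      apply orderOf_dvd_iff_pow_eq_one.1
      rw [← hkm, mul_comm]
      exact Nat.mul_dvd_mul ((Nat.modEq_zero_iff_dvd).1 hu0) dvd_rfl
    · intro q hq hqp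
      exact (Nat.prime_dvd_prime_iff_eq hq hp).1 (hq.dvd_of_dvd_pow hqp)
  · refine isPi_of_dvd (n := m) ?_ ?_
    · apply orderOf_dvd_of_pow_eq_one
      rw [← pow_mul]
      apply orderOf_dvd_iff_pow_eq_one.1
      rw [← hkm]
      exact Nat.mul_dvd_mul ((Nat.modEq_zero_iff_dvd).1 hv0) dvd_rfl
    · intro q hq hqm
      rcases hy q hq (hqm.trans ⟨p ^ k, by rw [← hkm, mul_comm]⟩) with h | h
      · exact absurd (h ▸ hqm) hpm
      · exact h

lemma kPi_insert_le {G : Type*} [Group G] [Finite G] (s : Set ℕ) (p : ℕ) (hp : p.Prime)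
    (M : ℕ) (hM : ∀ H : Subgroup G, kPi s H ≤ M) :
    kPi (insert p s) G ≤ kPi {p} G * M := by
  let T := {c : ConjClasses G | ∃ x : G, ConjClasses.mk x = c ∧ IsPiElement {p} x}
  let r : T → G := fun c => c.2.choose
  have hr : ∀ c : T, ConjClasses.mk (r c) = c.1 := fun c => c.2.choose_spec.1
  let D : T → Type _ := fun c => {d : ConjClasses (Subgroup.centralizer {r c}) |
    ∃ x, ConjClasses.mk x = d ∧ IsPiElement s x}
  let F : (Σ c : T, D c) → ConjClasses G := fun z =>
    ConjClasses.mk (r z.1 * (z.2.2.choose : G))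
  have hfin : Fintype T := Fintype.ofFinite _
  have hDf : ∀ c, Finite (D c) := fun c => by dsimp [D]; infer_instance
  have hcard : Nat.card (Σ c : T, D c) ≤ kPi {p} G * M := by
    rw [Nat.card_sigma]
    calc ∑ c : T, Nat.card (D c) ≤ ∑ c : T, M := Finset.sum_le_sum fun c _ => hM _
      _ = kPi {p} G * M := by
        rw [Finset.sum_const, smul_eq_mul, Finset.card_univ, ← Nat.card_eq_fintype_card]; rfl
  refine le_trans ?_ hcard
  rw [kPi_eq]
  refine le_trans (Set.ncard_le_ncard (t := Set.range F) ?_ (Set.toFinite _)) ?_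
  · rintro _ ⟨y, rfl, hy⟩
    obtain ⟨a, b, rfl, hab, ha, hb⟩ := p_decomp s p hp y hy
    let c : T := ⟨ConjClasses.mk a, a, rfl, ha⟩
    obtain ⟨g, hg⟩ := isConj_iff.1 (ConjClasses.mk_eq_mk_iff_isConj.1 (hr c).symm)
    have hmem : g * b * g⁻¹ ∈ Subgroup.centralizer {r c} := by
      rw [Subgroup.mem_centralizer_singleton_iff, ← hg]
      have := hab.eq
      calc g * b * g⁻¹ * (g * a * g⁻¹) = g * (b * a) * g⁻¹ := by group
        _ = g * (a * b) * g⁻¹ := by rw [this]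
        _ = _ := by group
    let b' : Subgroup.centralizer {r c} := ⟨g * b * g⁻¹, hmem⟩
    have hb' : IsPiElement s b' := by
      refine isPi_of_dvd (n := orderOf b) ?_ hb
      apply orderOf_dvd_of_pow_eq_one
      ext
      simp [b', conj_pow, pow_orderOf_eq_one]
    let d : D c := ⟨ConjClasses.mk b', b', rfl, hb'⟩
    refine ⟨⟨c, d⟩, ?_⟩
    have hd : ConjClasses.mk b' = ConjClasses.mk d.2.choose := d.2.choose_spec.1.symm
    obtain ⟨h, hh⟩ := isConj_iff.1 (ConjClasses.mk_eq_mk_iff_isConj.1 hd)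
    have hh' : (h : G) * (g * b * g⁻¹) * (h : G)⁻¹ = (d.2.choose : G) := by
      rw [← hh]; rfl
    change ConjClasses.mk (r c * (d.2.choose : G)) = _
    rw [← hh', eq_comm, ConjClasses.mk_eq_mk_iff_isConj, isConj_iff]
    refine ⟨h * g, ?_⟩
    have h2 := Subgroup.mem_centralizer_singleton_iff.1 h.2
    calc (h : G) * g * (a * b) * (h * g)⁻¹
        = h * (g * a * g⁻¹) * (g * b * g⁻¹) * (h : G)⁻¹ := by group
      _ = h * r c * (g * b * g⁻¹) * (h : G)⁻¹ := by rw [hg]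
      _ = r c * h * (g * b * g⁻¹) * (h : G)⁻¹ := by rw [h2]
      _ = _ := by group
  · rw [← Nat.card_coe_set_eq]
    exact Finite.card_range_le F

lemma kPi_single_le {G : Type*} [Group G] [Finite G] (p : ℕ) [Fact p.Prime] (P : Sylow p G) :
    kPi {p} G ≤ (Set.range (fun x : P => ConjClasses.mk (x : G))).ncard := by
  rw [kPi_eq]
  apply Set.ncard_le_ncard _ (Set.toFinite _)
  rintro _ ⟨x, rfl, hx⟩
  have hz : IsPGroup p (Subgroup.zpowers x) := by
    rw [IsPGroup.iff_card, Nat.card_zpowers]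
    refine ⟨_, Nat.eq_prime_pow_of_unique_prime_dvd (orderOf_pos x).ne' ?_⟩
    intro q hq hqx
    exact hx q hq hqx
  obtain ⟨Q, hQ⟩ := hz.exists_le_sylow
  obtain ⟨g, rfl⟩ := MulAction.exists_smul_eq G Q P
  refine ⟨⟨g * x * g⁻¹, ?_⟩, ?_⟩
  · have := Subgroup.smul_mem_pointwise_smul (MulAut.conj g • x) (MulAut.conj g) Q.1
    have h2 : x ∈ Q.1 := hQ (Subgroup.mem_zpowers x)
    have := Subgroup.smul_mem_pointwise_smul x (MulAut.conj g) Q.1 h2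
    exact this
  · exact ConjClasses.mk_eq_mk_iff_isConj.2 (isConj_iff.2 ⟨g, rfl⟩).symm

lemma kPi_single_two_thirds {G : Type*} [Group G] [Finite G] (p : ℕ) [hp : Fact p.Prime]
    (P : Sylow p G)
    (hN : ¬ Subgroup.normalizer (P : Set G) ≤ Subgroup.centralizer (P : Set G)) :
    3 * kPi {p} G ≤ 2 * Nat.card P := by
  have h0 := kPi_single_le p P
  set f : P → ConjClasses G := fun x : P => ConjClasses.mk (x : G) with hf
  by_cases hcomm : ∀ x y : P, x * y = y * x
  · obtain ⟨g, hgN, hgC⟩ := Set.not_subset.1 hN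
    let Z : Subgroup P := (Subgroup.centralizer {g}).subgroupOf P
    have hZ : ∀ x : P, x ∈ Z ↔ (x : G) * g = g * x := by
      intro x
      rw [Subgroup.mem_subgroupOf, Subgroup.mem_centralizer_singleton_iff]
    have hZtop : Z.index ≠ 1 := by
      intro h
      rw [Subgroup.index_eq_one] at h
      apply hgC
      intro x hx
      exact (hZ ⟨x, hx⟩).1 (h ▸ Subgroup.mem_top _)
    have hidx : Nat.card Z * Z.index = Nat.card P := Z.card_mul_index
    have hZc : (Z : Set P).ncard = Nat.card Z := (Nat.card_coe_set_eq _).symm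
    have hidx0 : Z.index ≠ 0 := Subgroup.FiniteIndex.index_ne_zero
    have hgc : ∀ x : P, g * x * g⁻¹ ∈ P := fun x =>
      (Subgroup.mem_normalizer_iff.1 hgN x).1 x.2
    have hfg : ∀ x : P, f ⟨g * x * g⁻¹, hgc x⟩ = f x := fun x =>
      ConjClasses.mk_eq_mk_iff_isConj.2 (isConj_iff.2 ⟨g, rfl⟩).symm
    have hne : ∀ x : P, x ∉ Z → (⟨g * x * g⁻¹, hgc x⟩ : P) ≠ x := by
      intro x hx h
      apply hx
      rw [hZ]
      have := congrArg Subtype.val h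
      simp only at this
      rw [mul_inv_eq_iff_eq_mul] at this
      exact this.symm
    by_cases hp2 : p = 2
    · have hle : 2 * Nat.card Z ≤ Nat.card P := by
        rw [← hidx, mul_comm]
        exact Nat.mul_le_mul_left _ (by omega)
      have := count_aux f (Z : Set P) 3 (by norm_num) (by
        intro x hx
        let y : P := ⟨g * x * g⁻¹, hgc x⟩
        let z : P := ⟨g * y * g⁻¹, hgc y⟩
        have hyx : y ≠ x := hne x hx
        have hzy : z ≠ y := by
          intro h
          apply hyx
          have := congrArg Subtype.val h
          ext
          simpa [z, y] using this
        have hzx : z ≠ x := by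
          intro h
          have h1 : Commute (g ^ 2) (x : G) := by
            have := congrArg Subtype.val h
            simp only [z, y] at this
            change g ^ 2 * x = x * g ^ 2
            calc g ^ 2 * x = (g * (g * x * g⁻¹) * g⁻¹) * g ^ 2 := by rw [pow_two]; group
              _ = _ := by rw [this]
          obtain ⟨k, m, hm, hgo⟩ := Nat.exists_eq_two_pow_mul_odd (orderOf_pos g).ne'
          have hPg : g ^ m ∈ P := by
            have hpg : IsPGroup p (Subgroup.zpowers (g ^ m)) := by
              subst hp2
              rw [IsPGroup.iff_card, Nat.card_zpowers]
              have : orderOf (g ^ m) ∣ 2 ^ k := by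
                apply orderOf_dvd_of_pow_eq_one
                rw [← pow_mul, mul_comm, ← hgo, pow_orderOf_eq_one]
              obtain ⟨j, -, hj⟩ := (Nat.dvd_prime_pow Nat.prime_two).1 this
              exact ⟨j, hj⟩
            have h5 := hpg.inf_normalizer_sylow P
            have : g ^ m ∈ Subgroup.zpowers (g ^ m) ⊓ (P : Subgroup G) := by
              rw [← h5]
              exact ⟨Subgroup.mem_zpowers _, Subgroup.pow_mem _ hgN m⟩
            exact this.2
          have h2 : Commute (g ^ m) (x : G) :=
            congrArg Subtype.val (hcomm ⟨_, hPg⟩ x)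
          obtain ⟨j, rfl⟩ := hm
          have h3 : Commute g (x : G) := by
            have h4 : Commute ((g ^ 2) ^ j) (x : G) := h1.pow_left j
            have : g = ((g ^ 2) ^ j)⁻¹ * g ^ (2 * j + 1) := by
              rw [pow_succ g (2 * j), pow_mul, inv_mul_cancel_left]
            rw [this]
            exact h4.inv_left.mul_left h2
          exact hx ((hZ x).2 h3.eq.symm)
        refine ⟨{x, y, z}, ?_, ?_⟩
        · rw [Finset.card_eq_three.2 ⟨x, y, z, hyx.symm, hzx.symm, hzy.symm, rfl⟩]
        · intro w hw
          simp only [Finset.mem_insert, Finset.mem_singleton] at hw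
          rcases hw with rfl | rfl | rfl
          · rfl
          · exact hfg x
          · exact (hfg y).trans (hfg x))
      rw [hZc] at this
      have hPP : Nat.card {x // x ∈ P} = Nat.card (P : Subgroup G) := rfl
      omega
    · have hle : 3 * Nat.card Z ≤ Nat.card P := by
        rw [← hidx, mul_comm]
        refine Nat.mul_le_mul_left _ ?_
        have : Z.index ≠ 2 := by
          intro h
          obtain ⟨n, hn⟩ := IsPGroup.iff_card.1 P.2
          have h2 : 2 ∣ p ^ n := by
            rw [← hn]; exact ⟨Nat.card Z, by rw [← h, mul_comm]; exact hidx.symm⟩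
          exact hp2 ((Nat.prime_dvd_prime_iff_eq Nat.prime_two hp.out).1
            (Nat.prime_two.dvd_of_dvd_pow h2)).symm
        omega
      have := count_aux f (Z : Set P) 2 (by norm_num) (by
        intro x hx
        refine ⟨{x, ⟨g * x * g⁻¹, hgc x⟩}, ?_, ?_⟩
        · rw [Finset.card_pair (hne x hx).symm]
        · intro w hw
          simp only [Finset.mem_insert, Finset.mem_singleton] at hw
          rcases hw with rfl | rfl
          · rfl
          · exact hfg x)
      rw [hZc] at this
      have hPP : Nat.card {x // x ∈ P} = Nat.card (P : Subgroup G) := rfl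
      omega
  · let Z := Subgroup.center P
    have hidx : Nat.card Z * Z.index = Nat.card P := Z.card_mul_index
    have hZc : (Z : Set P).ncard = Nat.card Z := (Nat.card_coe_set_eq _).symm
    have hidx0 : Z.index ≠ 0 := Subgroup.FiniteIndex.index_ne_zero
    have hnc : ¬ IsCyclic (P ⧸ Z) := by
      intro h
      apply hcomm
      have hk : (QuotientGroup.mk' Z).ker ≤ Subgroup.center (P : Subgroup G) := by
        rw [QuotientGroup.ker_mk']
      have := MonoidHom.isMulCommutative_of_isCyclic_of_ker_le_center (QuotientGroup.mk' Z) hk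
      exact fun x y => this.is_comm.comm x y
    have h1 : Z.index ≠ 1 := by
      intro h
      apply hnc
      have : Subsingleton (P ⧸ Z) := (Nat.card_eq_one_iff_unique.1 h).1
      infer_instance
    have h2 : Z.index ≠ 2 := by
      intro h
      apply hnc
      have : Fact (Nat.Prime 2) := ⟨Nat.prime_two⟩
      exact isCyclic_of_prime_card (p := 2) h
    have hle : 3 * Nat.card Z ≤ Nat.card P := by
      rw [← hidx, mul_comm]
      exact Nat.mul_le_mul_left _ (by omega)
    have := count_aux f (Z : Set P) 2 (by norm_num) (by
      intro x hx
      have : ∃ g : P, g * x ≠ x * g := by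
        by_contra! hh
        exact hx (Subgroup.mem_center_iff.2 hh)
      obtain ⟨g, hg⟩ := this
      refine ⟨{x, g * x * g⁻¹}, ?_, ?_⟩
      · rw [Finset.card_pair]
        intro h
        exact hg (eq_mul_inv_iff_mul_eq.1 h).symm
      · intro w hw
        simp only [Finset.mem_insert, Finset.mem_singleton] at hw
        rcases hw with rfl | rfl
        · rfl
        · exact ConjClasses.mk_eq_mk_iff_isConj.2 (isConj_iff.2 ⟨(g : G), rfl⟩).symm)
    rw [hZc] at this
    have hPP : Nat.card {x // x ∈ P} = Nat.card (P : Subgroup G) := rfl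
    omega

lemma M_le {s : Finset ℕ} {G : Type*} [Group G] [Finite G] (hs : ∀ p ∈ s, p.Prime)
    (H : Subgroup G) :
    ∏ p ∈ s, p ^ (Nat.card H).factorization p ≤ ∏ p ∈ s, p ^ (Nat.card G).factorization p := by
  apply Finset.prod_le_prod'
  intro p hp
  apply Nat.pow_le_pow_right (hs p hp).pos
  exact (Nat.factorization_le_iff_dvd Nat.card_pos.ne' Nat.card_pos.ne').2
    H.card_subgroup_dvd_card p

lemma kPi_finset_le (s : Finset ℕ) : (∀ p ∈ s, p.Prime) → ∀ (G : Type*) [Group G] [Finite G],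
    kPi (s : Set ℕ) G ≤ ∏ p ∈ s, p ^ (Nat.card G).factorization p := by
  induction s using Finset.induction_on with
  | empty =>
    intro _ G _ _
    rw [kPi_eq, Finset.prod_empty, Set.ncard_le_one]
    rintro _ ⟨x, rfl, hx⟩ _ ⟨y, rfl, hy⟩
    have key : ∀ x : G, IsPiElement ((∅ : Finset ℕ) : Set ℕ) x → x = 1 := by
      intro x hx
      rw [← orderOf_eq_one_iff]
      by_contra h
      obtain ⟨q, hq, hqx⟩ := Nat.exists_prime_and_dvd h
      simpa using hx q hq hqx
    rw [key x hx, key y hy]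
  | insert p s hps ih =>
    intro hs G _ _
    have hp : Fact p.Prime := ⟨hs p (by simp)⟩
    have hs' : ∀ q ∈ s, q.Prime := fun q hq => hs q (by simp [hq])
    rw [Finset.prod_insert hps, Finset.coe_insert]
    refine (kPi_insert_le (s : Set ℕ) p hp.out _ (fun H => (ih hs' H).trans
      (M_le hs' H))).trans ?_
    have P : Sylow p G := default
    refine Nat.mul_le_mul_right _ ?_
    refine (kPi_single_le p P).trans ?_
    rw [← P.card_eq_multiplicity, ← Nat.card_coe_set_eq]
    exact Finite.card_range_le _

lemma burnside_part {G : Type*} [Group G] [Finite G] (s : Finset ℕ) (hs : ∀ p ∈ s, p.Prime)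
    (P : ∀ p : ℕ, Sylow p G)
    (hN : ∀ p ∈ s,
      Subgroup.normalizer (P p : Set G) ≤ Subgroup.centralizer (P p : Set G)) :
    ∏ p ∈ s, p ^ (Nat.card G).factorization p ≤ kPi (s : Set ℕ) G := by
  have hF : ∀ p : s, Fact (p : ℕ).Prime := fun p => ⟨hs p p.2⟩
  have hcP : ∀ p : s, Nat.card (P p) = (p : ℕ) ^ (Nat.card G).factorization p :=
    fun p => (P p).card_eq_multiplicity
  have hab : ∀ (p : s) (x y : P p), x * y = y * x := by
    intro p x y
    ext
    exact (hN p p.2 (Subgroup.le_normalizer x.2) y y.2).symm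
  let Φ : G →* (∀ p : s, P p) := MonoidHom.pi fun p => MonoidHom.transferSylow (P p) (hN p p.2)
  set a := ∏ p ∈ s, p ^ (Nat.card G).factorization p with ha
  have ha0 : 0 < a := Finset.prod_pos fun p hp => pow_pos (hs p hp).pos _
  have hpa : ∀ p : s, Nat.card (P p) ∣ a := fun p => by
    rw [hcP]; exact Finset.dvd_prod_of_mem (fun p => p ^ (Nat.card G).factorization p) p.2
  -- size of the range
  have hrange : a ≤ Nat.card Φ.range := by
    apply Nat.le_of_dvd Nat.card_pos
    apply Finset.prod_dvd_of_isRelPrime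
    · intro p hp q hq hpq
      exact Nat.coprime_iff_isRelPrime.1 <|
        Nat.Coprime.pow _ _ ((Nat.coprime_primes (hs p hp) (hs q hq)).2 hpq)
    · intro p hp
      have hFp : Fact p.Prime := ⟨hs p hp⟩
      have hc := MonoidHom.ker_transferSylow_isComplement' (P p) (hN p hp)
      have h1 := hc.card_mul_card
      have h2 := Subgroup.card_mul_index (MonoidHom.transferSylow (P p) (hN p hp)).ker
      rw [Subgroup.index_ker] at h2
      have h3 : Nat.card (MonoidHom.transferSylow (P p) (hN p hp)).range = Nat.card (P p) :=
        Nat.eq_of_mul_eq_mul_left Nat.card_pos (h2.trans h1.symm)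
      have h4 : (MonoidHom.transferSylow (P p) (hN p hp)).range
          = Φ.range.map (Pi.evalMonoidHom (fun p : s => P p) ⟨p, hp⟩) := by
        rw [← MonoidHom.range_comp]; rfl
      have h5 := Subgroup.card_map_dvd Φ.range (Pi.evalMonoidHom (fun p : s => P p) ⟨p, hp⟩)
      rw [← h4, h3] at h5
      exact (hcP ⟨p, hp⟩) ▸ h5
  have hprime : ∀ q : ℕ, q.Prime → q ∣ a → q ∈ (s : Set ℕ) := by
    intro q hq hqa
    obtain ⟨p, hp, hqp⟩ := (Prime.dvd_finsetProd_iff hq.prime _).1 hqa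
    rw [(Nat.prime_dvd_prime_iff_eq hq (hs p hp)).1 (hq.dvd_of_dvd_pow hqp)]
    exact hp
  have hadvd : a ∣ Nat.card G := by
    apply Finset.prod_dvd_of_isRelPrime
    · intro p hp q hq hpq
      exact Nat.coprime_iff_isRelPrime.1 <|
        Nat.Coprime.pow _ _ ((Nat.coprime_primes (hs p hp) (hs q hq)).2 hpq)
    · intro p hp
      exact Nat.ordProj_dvd _ _
  obtain ⟨b, hb⟩ := hadvd
  have hcop : Nat.Coprime a b := by
    apply Nat.coprime_of_dvd
    intro q hq hqa hqb
    have hqs : q ∈ s := hprime q hq hqa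
    have h1 : q ^ ((Nat.card G).factorization q + 1) ∣ Nat.card G := by
      conv_rhs => rw [hb]
      rw [pow_succ]
      exact Nat.mul_dvd_mul
        (Finset.dvd_prod_of_mem (fun p => p ^ (Nat.card G).factorization p) hqs) hqb
    exact Nat.pow_succ_factorization_not_dvd Nat.card_pos.ne' hq h1
  obtain ⟨u, hu1, hu0⟩ := Nat.chineseRemainder hcop 1 0
  let T := {c : ConjClasses G | ∃ x : G, ConjClasses.mk x = c ∧ IsPiElement (s : Set ℕ) x}
  let F : T → (∀ p : s, P p) := fun c => Φ c.2.choose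
  have hsub : (Φ.range : Set (∀ p : s, P p)) ⊆ Set.range F := by
    rintro _ ⟨g, rfl⟩
    have hgu : IsPiElement (s : Set ℕ) (g ^ u) := by
      refine isPi_of_dvd (n := a) ?_ hprime
      apply orderOf_dvd_of_pow_eq_one
      rw [← pow_mul]
      apply orderOf_dvd_iff_pow_eq_one.1
      refine (orderOf_dvd_natCard g).trans ?_
      rw [hb, mul_comm]
      exact Nat.mul_dvd_mul ((Nat.modEq_zero_iff_dvd).1 hu0) dvd_rfl
    let c : T := ⟨ConjClasses.mk (g ^ u), g ^ u, rfl, hgu⟩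
    refine ⟨c, ?_⟩
    obtain ⟨h, hh⟩ := isConj_iff.1 (ConjClasses.mk_eq_mk_iff_isConj.1 c.2.choose_spec.1)
    have e1 : Φ c.2.choose = Φ (g ^ u) := by
      rw [← hh, map_mul, map_mul, map_inv]
      funext p
      simp only [Pi.mul_apply, Pi.inv_apply]
      rw [hab p (Φ h p), mul_inv_cancel_right]
    have e2 : Φ (g ^ u) = Φ g := by
      rw [map_pow]
      have : orderOf (Φ g) ∣ a := by
        apply orderOf_dvd_of_pow_eq_one
        funext p
        rw [Pi.pow_apply]
        exact orderOf_dvd_iff_pow_eq_one.1 ((orderOf_dvd_natCard _).trans (hpa p))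
      conv_rhs => rw [← pow_one (Φ g)]
      exact pow_eq_pow_iff_modEq.2 (hu1.of_dvd this)
    exact e1.trans e2
  calc a ≤ Nat.card Φ.range := hrange
    _ = (Φ.range : Set (∀ p : s, P p)).ncard := Nat.card_coe_set_eq _
    _ ≤ (Set.range F).ncard := Set.ncard_le_ncard hsub (Set.toFinite _)
    _ ≤ Nat.card T := by rw [← Nat.card_coe_set_eq]; exact Finite.card_range_le F

/-- If `d_π(G) < 1` then `d_π(G) ≤ 2/3`. -/
theorem dPi_le_two_thirds_of_dPi_lt_one
    {G : Type*} [Group G] [Finite G] (π : Set ℕ)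
    (hπ : ∀ p ∈ π, Nat.Prime p) (h : dPi π G < 1) :
    dPi π G ≤ 2 / 3 := by
  set s := (Nat.card G).primeFactors.filter (· ∈ π) with hsdef
  have hs : ∀ p ∈ s, p.Prime := fun p hp => hπ p (Finset.mem_filter.1 hp).2
  have hP : piPart π (Nat.card G) = ∏ p ∈ s, p ^ (Nat.card G).factorization p := by
    unfold piPart
    rw [Finsupp.prod, Nat.support_factorization, hsdef, Finset.prod_filter]
  have hk : kPi π G = kPi (s : Set ℕ) G := by
    have : ∀ x : G, IsPiElement π x ↔ IsPiElement (s : Set ℕ) x := by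
      intro x
      refine forall₃_congr fun q hq hqx => ?_
      have : q ∈ (Nat.card G).primeFactors :=
        Nat.mem_primeFactors.2 ⟨hq, hqx.trans (orderOf_dvd_natCard x), Nat.card_pos.ne'⟩
      rw [Finset.mem_coe, hsdef, Finset.mem_filter]
      tauto
    unfold kPi
    simp only [this]
  have hpos : 0 < ∏ p ∈ s, p ^ (Nat.card G).factorization p :=
    Finset.prod_pos fun p hp => pow_pos (hs p hp).pos _
  have hposQ : (0 : ℚ) < ((∏ p ∈ s, p ^ (Nat.card G).factorization p : ℕ) : ℚ) := by
    exact_mod_cast hpos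
  unfold dPi at h ⊢
  rw [hP, hk] at h ⊢
  rw [div_lt_one hposQ] at h
  have h' : kPi (s : Set ℕ) G < ∏ p ∈ s, p ^ (Nat.card G).factorization p := by exact_mod_cast h
  have hex : ∃ p ∈ s, ∃ P : Sylow p G,
      ¬ Subgroup.normalizer (P : Set G) ≤ Subgroup.centralizer (P : Set G) := by
    by_contra! hcon
    exact absurd (burnside_part s hs (fun p => default) (fun p hp => hcon p hp _)) (not_le.2 h')
  obtain ⟨p, hps, P, hN⟩ := hex
  have hp : Fact p.Prime := ⟨hs p hps⟩
  have h1 := kPi_single_two_thirds p P hN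
  have hs' : ∀ q ∈ s.erase p, q.Prime := fun q hq => hs q (Finset.mem_of_mem_erase hq)
  have h2 := kPi_insert_le (G := G) ((s.erase p : Finset ℕ) : Set ℕ) p hp.out _
    (fun H => (kPi_finset_le (s.erase p) hs' H).trans (M_le hs' H))
  rw [← Finset.coe_insert, Finset.insert_erase hps] at h2
  rw [div_le_div_iff₀ hposQ (by norm_num)]
  rw [P.card_eq_multiplicity] at h1
  rw [← Finset.mul_prod_erase s _ hps]
  have h3 : kPi (s : Set ℕ) G * 3 ≤ 2 * (p ^ (Nat.card G).factorization p *
      ∏ q ∈ s.erase p, q ^ (Nat.card G).factorization q) := by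
    nlinarith [Nat.mul_le_mul_right
      (∏ q ∈ s.erase p, q ^ (Nat.card G).factorization q) h1]
  exact_mod_cast h3
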